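/- Let U ⊆ ℂ × ℂ be open, x ∈ U, let a, b be nonvanishing holomorphic functions on U, and let η = (0, a, b, 0) be the symmetric 3-differential a dz²dw + b dz dw². Then η is closed at x if and only if there exist an open polydisc D = D1 × D2 ⊆ U containing x, a nonvanishing holomorphic function Z on D1, a nonvanishing holomorphic function W on D2, and a holomorphic function H on D such that a(z,w) = Z(z)·W(w)·H_z(z,w) and b(z,w) = Z(z)·W(w)·H_w(z,w) for all (z,w) ∈ D. -/

import Mathlib

noncomputable section

/-- Partial derivative in the first (`z`) variable. -/
def pz (F : ℂ × ℂ → ℂ) (p : ℂ × ℂ) : ℂ := fderiv ℂ F p (1, 0)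

/-- Partial derivative in the second (`w`) variable. -/
def pw (F : ℂ × ℂ → ℂ) (p : ℂ × ℂ) : ℂ := fderiv ℂ F p (0, 1)

/-- A 1-form `P dz + Q dw` given by its pair of coefficient functions. -/
abbrev Form1 := (ℂ × ℂ → ℂ) × (ℂ × ℂ → ℂ)

/-- A 1-form is holomorphic on `U` if both coefficients are. -/
def HoloForm (ω : Form1) (U : Set (ℂ × ℂ)) : Prop :=
  DifferentiableOn ℂ ω.1 U ∧ DifferentiableOn ℂ ω.2 U

/-- Wedge product of two 1-forms (coefficient of `dz ∧ dw`). -/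
def wedge (ω ω' : Form1) (p : ℂ × ℂ) : ℂ := ω.1 p * ω'.2 p - ω.2 p * ω'.1 p

/-- Exterior derivative `Q_z - P_w` of `P dz + Q dw` (coefficient of `dz ∧ dw`). -/
def dForm (ω : Form1) (p : ℂ × ℂ) : ℂ := pz ω.2 p - pw ω.1 p

/-- A 1-form `P dz + Q dw` is closed on `V` if `P_w = Q_z` there. -/
def IsClosed1 (ω : Form1) (V : Set (ℂ × ℂ)) : Prop := ∀ p ∈ V, pw ω.1 p = pz ω.2 p

/-- The differential of a function, as a 1-form. -/
def dfun (φ : ℂ × ℂ → ℂ) : Form1 := (pz φ, pw φ)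

def addF (ω ω' : Form1) : Form1 := (fun p => ω.1 p + ω'.1 p, fun p => ω.2 p + ω'.2 p)
def subF (ω ω' : Form1) : Form1 := (fun p => ω.1 p - ω'.1 p, fun p => ω.2 p - ω'.2 p)
def fsmul (h : ℂ × ℂ → ℂ) (ω : Form1) : Form1 :=
  (fun p => h p * ω.1 p, fun p => h p * ω.2 p)
def csmul (c : ℂ) (ω : Form1) : Form1 := (fun p => c * ω.1 p, fun p => c * ω.2 p)

/-- Coefficients of the symmetric product of three 1-forms. -/
def symC0 (a b c : Form1) (p : ℂ × ℂ) : ℂ := a.1 p * b.1 p * c.1 p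
def symC1 (a b c : Form1) (p : ℂ × ℂ) : ℂ :=
  a.1 p * b.1 p * c.2 p + a.1 p * b.2 p * c.1 p + a.2 p * b.1 p * c.1 p
def symC2 (a b c : Form1) (p : ℂ × ℂ) : ℂ :=
  a.1 p * b.2 p * c.2 p + a.2 p * b.1 p * c.2 p + a.2 p * b.2 p * c.1 p
def symC3 (a b c : Form1) (p : ℂ × ℂ) : ℂ := a.2 p * b.2 p * c.2 p

/-- The symmetric 3-differential `c0 dz³ + c1 dz²dw + c2 dz dw² + c3 dw³` is
non-degenerate at `x` if the binary cubic `c0 s³ + c1 s²t + c2 st² + c3 t³` is nonzero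
and has three pairwise non-proportional roots in the projective line. -/
def NonDegAt (c0 c1 c2 c3 : ℂ × ℂ → ℂ) (x : ℂ × ℂ) : Prop :=
  (c0 x ≠ 0 ∨ c1 x ≠ 0 ∨ c2 x ≠ 0 ∨ c3 x ≠ 0) ∧
  ∃ r : Fin 3 → ℂ × ℂ,
    (∀ i j, i ≠ j → (r i).1 * (r j).2 - (r i).2 * (r j).1 ≠ 0) ∧
    (∀ i, c0 x * (r i).1 ^ 3 + c1 x * (r i).1 ^ 2 * (r i).2 +
          c2 x * (r i).1 * (r i).2 ^ 2 + c3 x * (r i).2 ^ 3 = 0)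

/-- A symmetric 3-differential is closed at `x` if on some open neighborhood of `x`
(inside `U`) it is a symmetric product of three closed holomorphic 1-forms. -/
def ClosedAt (U : Set (ℂ × ℂ)) (c0 c1 c2 c3 : ℂ × ℂ → ℂ) (x : ℂ × ℂ) : Prop :=
  ∃ V : Set (ℂ × ℂ), IsOpen V ∧ x ∈ V ∧ V ⊆ U ∧
    ∃ z1 z2 z3 : Form1,
      HoloForm z1 V ∧ HoloForm z2 V ∧ HoloForm z3 V ∧
      IsClosed1 z1 V ∧ IsClosed1 z2 V ∧ IsClosed1 z3 V ∧
      ∀ p ∈ V, c0 p = symC0 z1 z2 z3 p ∧ c1 p = symC1 z1 z2 z3 p ∧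
               c2 p = symC2 z1 z2 z3 p ∧ c3 p = symC3 z1 z2 z3 p

/-- `D1 × D2` is an open polydisc. -/
def IsPolydisc (D1 D2 : Set ℂ) : Prop :=
  ∃ z0 w0 : ℂ, ∃ r1 r2 : ℝ, 0 < r1 ∧ 0 < r2 ∧
    D1 = Metric.ball z0 r1 ∧ D2 = Metric.ball w0 r2

/-- `A = ∂_z(a_w/a)`. -/
def Afun (a : ℂ × ℂ → ℂ) : ℂ × ℂ → ℂ := pz (fun p => pw a p / a p)

/-- `B = ∂_w(b_z/b)`. -/
def Bfun (b : ℂ × ℂ → ℂ) : ℂ × ℂ → ℂ := pw (fun p => pz b p / b p)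

/-- `ξ = (1/(A−B))·[ a·∂_z((b/a)·B) − b·∂_w((a/b)·A) ]`. -/
def xifun (a b : ℂ × ℂ → ℂ) : ℂ × ℂ → ℂ := fun p =>
  (Afun a p - Bfun b p)⁻¹ *
    (a p * pz (fun q => b q / a q * Bfun b q) p -
     b p * pw (fun q => a q / b q * Afun a q) p)

open Filter Topology

lemma hasDerivAt_slice_fst {F : ℂ × ℂ → ℂ} {z w : ℂ} (hF : DifferentiableAt ℂ F (z, w)) :
    HasDerivAt (fun t => F (t, w)) (pz F (z, w)) z :=
  HasFDerivAt.comp_hasDerivAt z hF.hasFDerivAt ((hasDerivAt_id z).prodMk (hasDerivAt_const z w))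

lemma hasDerivAt_slice_snd {F : ℂ × ℂ → ℂ} {z w : ℂ} (hF : DifferentiableAt ℂ F (z, w)) :
    HasDerivAt (fun t => F (z, t)) (pw F (z, w)) w :=
  HasFDerivAt.comp_hasDerivAt w hF.hasFDerivAt ((hasDerivAt_const w z).prodMk (hasDerivAt_id w))

lemma fderiv_apply_eq (F : ℂ × ℂ → ℂ) (p v : ℂ × ℂ) :
    fderiv ℂ F p v = v.1 * pz F p + v.2 * pw F p := by
  have hv : v = v.1 • ((1, 0) : ℂ × ℂ) + v.2 • ((0, 1) : ℂ × ℂ) := by ext <;> simp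
  conv_lhs => rw [hv, map_add, map_smul, map_smul]
  rfl

lemma fderiv_eq_zero_of_eqOn_zero {F : ℂ × ℂ → ℂ} {D : Set (ℂ × ℂ)} (hD : IsOpen D)
    (hF : ∀ p ∈ D, F p = 0) {p : ℂ × ℂ} (hp : p ∈ D) : fderiv ℂ F p = 0 := by
  have h : F =ᶠ[𝓝 p] fun _ => 0 := eventually_of_mem (hD.mem_nhds hp) hF
  rw [h.fderiv_eq, fderiv_fun_const]
  rfl

lemma eq_of_pz_eq_zero {F : ℂ × ℂ → ℂ} {D1 D2 : Set ℂ} (h1 : IsOpen D1) (h2 : IsOpen D2)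
    (hc : IsPreconnected D1) (hF : DifferentiableOn ℂ F (D1 ×ˢ D2))
    (h0 : ∀ p ∈ D1 ×ˢ D2, pz F p = 0) {z z' w : ℂ} (hz : z ∈ D1) (hz' : z' ∈ D1) (hw : w ∈ D2) :
    F (z, w) = F (z', w) := by
  have hd : ∀ t ∈ D1, HasDerivAt (fun t => F (t, w)) 0 t := fun t ht => by
    have h := hasDerivAt_slice_fst (hF.differentiableAt ((h1.prod h2).mem_nhds ⟨ht, hw⟩))
    rwa [h0 (t, w) ⟨ht, hw⟩] at h
  exact h1.is_const_of_deriv_eq_zero hc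
    (fun t ht => (hd t ht).differentiableAt.differentiableWithinAt)
    (fun t ht => (hd t ht).deriv) hz hz'

lemma eq_of_pw_eq_zero {F : ℂ × ℂ → ℂ} {D1 D2 : Set ℂ} (h1 : IsOpen D1) (h2 : IsOpen D2)
    (hc : IsPreconnected D2) (hF : DifferentiableOn ℂ F (D1 ×ˢ D2))
    (h0 : ∀ p ∈ D1 ×ˢ D2, pw F p = 0) {z w w' : ℂ} (hz : z ∈ D1) (hw : w ∈ D2) (hw' : w' ∈ D2) :
    F (z, w) = F (z, w') := by
  have hd : ∀ t ∈ D2, HasDerivAt (fun t => F (z, t)) 0 t := fun t ht => by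
    have h := hasDerivAt_slice_snd (hF.differentiableAt ((h1.prod h2).mem_nhds ⟨hz, ht⟩))
    rwa [h0 (z, t) ⟨hz, ht⟩] at h
  exact h2.is_const_of_deriv_eq_zero hc
    (fun t ht => (hd t ht).differentiableAt.differentiableWithinAt)
    (fun t ht => (hd t ht).deriv) hw hw'

/-- A 1-form as a field of continuous linear functionals. -/
def Form1.toCLM (ω : Form1) (p : ℂ × ℂ) : ℂ × ℂ →L[ℂ] ℂ :=
  ω.1 p • ContinuousLinearMap.fst ℂ ℂ ℂ + ω.2 p • ContinuousLinearMap.snd ℂ ℂ ℂ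

lemma Form1.hasFDerivAt_toCLM {ω : Form1} {p : ℂ × ℂ} (h1 : DifferentiableAt ℂ ω.1 p)
    (h2 : DifferentiableAt ℂ ω.2 p) :
    HasFDerivAt ω.toCLM
      ((fderiv ℂ ω.1 p).smulRight (ContinuousLinearMap.fst ℂ ℂ ℂ) +
        (fderiv ℂ ω.2 p).smulRight (ContinuousLinearMap.snd ℂ ℂ ℂ)) p :=
  (h1.hasFDerivAt.smul_const (ContinuousLinearMap.fst ℂ ℂ ℂ)).add
    (h2.hasFDerivAt.smul_const (ContinuousLinearMap.snd ℂ ℂ ℂ))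

lemma exists_primitive {ω : Form1} {D : Set (ℂ × ℂ)} (hD : IsOpen D) (hconv : Convex ℝ D)
    (hω : HoloForm ω D) (hcl : IsClosed1 ω D) :
    ∃ H : ℂ × ℂ → ℂ, DifferentiableOn ℂ H D ∧ ∀ p ∈ D, pz H p = ω.1 p ∧ pw H p = ω.2 p := by
  have hd : ∀ p ∈ D, HasFDerivAt ω.toCLM _ p := fun p hp => Form1.hasFDerivAt_toCLM
    (hω.1.differentiableAt (hD.mem_nhds hp)) (hω.2.differentiableAt (hD.mem_nhds hp))
  obtain ⟨H, hH⟩ := hconv.exists_forall_hasFDerivWithinAt_of_hasFDerivWithinAt_symmetric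
    (fun p hp => ((hd p hp).restrictScalars ℝ).hasFDerivWithinAt) (by
      intro p hp u _ v _
      have hp' := hcl p hp
      simp only [ContinuousLinearMap.coe_restrictScalars', add_apply,
        ContinuousLinearMap.smulRight_apply, smul_apply,
        ContinuousLinearMap.coe_fst', ContinuousLinearMap.coe_snd', fderiv_apply_eq, smul_eq_mul]
      linear_combination (u.2 * v.1 - u.1 * v.2) * hp')
  have hH' : ∀ p ∈ D, HasFDerivAt H (ω.toCLM p) p := fun p hp =>
    (hH p hp).hasFDerivAt (hD.mem_nhds hp)
  refine ⟨H, fun p hp => (hH' p hp).differentiableAt.differentiableWithinAt, fun p hp => ?_⟩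
  simp [pz, pw, (hH' p hp).fderiv, Form1.toCLM]

lemma isClosed1_dfun {H : ℂ × ℂ → ℂ} {D : Set (ℂ × ℂ)} (hD : IsOpen D)
    (hH : DifferentiableOn ℂ H D) (hdH : HoloForm (dfun H) D) : IsClosed1 (dfun H) D := by
  intro p hp
  have hev : ∀ᶠ q in 𝓝 p, HasFDerivAt H ((dfun H).toCLM q) q := by
    filter_upwards [hD.mem_nhds hp] with q hq
    have h := (hH.differentiableAt (hD.mem_nhds hq)).hasFDerivAt
    have he : (dfun H).toCLM q = fderiv ℂ H q := ContinuousLinearMap.ext fun v => by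
      rw [fderiv_apply_eq]
      simp [Form1.toCLM, dfun, mul_comm]
    rwa [he]
  have h := second_derivative_symmetric_of_eventually hev (Form1.hasFDerivAt_toCLM
    (hdH.1.differentiableAt (hD.mem_nhds hp)) (hdH.2.differentiableAt (hD.mem_nhds hp)))
    (0, 1) (1, 0)
  simpa [pz, pw] using h

/-- The forms `ω1`, `ω2`, `ω3` are closed and holomorphic on `V`, with symmetric product
`a dz²dw + b dz dw²`. -/
def IsClosedFactorization (V : Set (ℂ × ℂ)) (a b : ℂ × ℂ → ℂ) (ω1 ω2 ω3 : Form1) : Prop :=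
  HoloForm ω1 V ∧ HoloForm ω2 V ∧ HoloForm ω3 V ∧
    IsClosed1 ω1 V ∧ IsClosed1 ω2 V ∧ IsClosed1 ω3 V ∧
    ∀ p ∈ V, 0 = symC0 ω1 ω2 ω3 p ∧ a p = symC1 ω1 ω2 ω3 p ∧
      b p = symC2 ω1 ω2 ω3 p ∧ 0 = symC3 ω1 ω2 ω3 p

namespace IsClosedFactorization

variable {V : Set (ℂ × ℂ)} {a b : ℂ × ℂ → ℂ} {ω1 ω2 ω3 : Form1} {x : ℂ × ℂ}

lemma swap_left (h : IsClosedFactorization V a b ω1 ω2 ω3) :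
    IsClosedFactorization V a b ω2 ω1 ω3 := by
  obtain ⟨h1, h2, h3, c1, c2, c3, he⟩ := h
  refine ⟨h2, h1, h3, c2, c1, c3, fun p hp => ?_⟩
  obtain ⟨e0, e1, e2, e3⟩ := he p hp
  refine ⟨e0.trans ?_, e1.trans ?_, e2.trans ?_, e3.trans ?_⟩ <;>
    simp only [symC0, symC1, symC2, symC3] <;> ring

lemma swap_right (h : IsClosedFactorization V a b ω1 ω2 ω3) :
    IsClosedFactorization V a b ω1 ω3 ω2 := by
  obtain ⟨h1, h2, h3, c1, c2, c3, he⟩ := h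
  refine ⟨h1, h3, h2, c1, c3, c2, fun p hp => ?_⟩
  obtain ⟨e0, e1, e2, e3⟩ := he p hp
  refine ⟨e0.trans ?_, e1.trans ?_, e2.trans ?_, e3.trans ?_⟩ <;>
    simp only [symC0, symC1, symC2, symC3] <;> ring

/-- The factors can be ordered so that at `x` the first is a multiple of `dw` and the second
a multiple of `dz`. -/
lemma exists_ordered (h : IsClosedFactorization V a b ω1 ω2 ω3) (hx : x ∈ V)
    (ha : a x ≠ 0) :
    ∃ σ1 σ2 σ3 : Form1, IsClosedFactorization V a b σ1 σ2 σ3 ∧ σ1.1 x = 0 ∧ σ2.2 x = 0 := by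
  obtain ⟨e0, e1, -, e3⟩ := h.2.2.2.2.2.2 x hx
  simp only [symC0, symC1, symC3] at e0 e1 e3
  rw [e1] at ha
  have h0 := e0.symm
  have h3 := e3.symm
  simp only [mul_eq_zero, or_assoc] at h0 h3
  rcases h0 with p | p | p <;> rcases h3 with q | q | q
  · simp [p, q] at ha
  · exact ⟨_, _, _, h, p, q⟩
  · exact ⟨_, _, _, h.swap_right, p, q⟩
  · exact ⟨_, _, _, h.swap_left, p, q⟩
  · simp [p, q] at ha
  · exact ⟨_, _, _, h.swap_left.swap_right, p, q⟩
  · exact ⟨_, _, _, h.swap_right.swap_left, p, q⟩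
  · exact ⟨_, _, _, h.swap_right.swap_left.swap_right, p, q⟩
  · simp [p, q] at ha

lemma exists_polydisc (h : IsClosedFactorization V a b ω1 ω2 ω3) (hV : IsOpen V) (hx : x ∈ V)
    (ha : a x ≠ 0) (hb : b x ≠ 0) (h1 : ω1.1 x = 0) (h2 : ω2.2 x = 0) :
    ∃ r > 0, Metric.ball x r ⊆ V ∧ ∀ p ∈ Metric.ball x r,
      ω1.1 p = 0 ∧ ω2.2 p = 0 ∧ ω2.1 p ≠ 0 ∧ ω1.2 p ≠ 0 := by
  obtain ⟨d1, d2, d3, -, -, -, he⟩ := h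
  obtain ⟨-, e1, e2, -⟩ := he x hx
  simp only [symC1, symC2, h1, h2] at e1 e2
  rw [e1] at ha
  rw [e2] at hb
  have hne : ∀ f : ℂ × ℂ → ℂ, DifferentiableOn ℂ f V → f x ≠ 0 → ∀ᶠ p in 𝓝 x, f p ≠ 0 :=
    fun f hf h0 => (hf.continuousOn.continuousAt (hV.mem_nhds hx)).eventually_ne h0
  have hev : ∀ᶠ p in 𝓝 x, p ∈ V ∧ ω1.1 p = 0 ∧ ω2.2 p = 0 ∧ ω2.1 p ≠ 0 ∧ ω1.2 p ≠ 0 := by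
    filter_upwards [hV.mem_nhds hx, hne _ d2.1 (by rintro h; simp [h] at ha),
      hne _ d3.1 (by rintro h; simp [h] at ha), hne _ d1.2 (by rintro h; simp [h] at ha),
      hne _ d3.2 (by rintro h; simp [h] at hb)] with p hp n1 n2 n3 n4
    obtain ⟨e0, -, -, e3⟩ := he p hp
    have e0' := e0.symm
    have e3' := e3.symm
    simp only [symC0, symC3, mul_eq_zero, n1, n2, n3, n4, or_false, false_or] at e0' e3'
    exact ⟨hp, e0', e3', n1, n3⟩
  obtain ⟨r, hr, hball⟩ := Metric.eventually_nhds_iff_ball.1 hev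
  exact ⟨r, hr, fun p hp => (hball p hp).1, fun p hp => (hball p hp).2⟩

end IsClosedFactorization

/-- `η = a dz²dw + b dz dw²` is closed at `x` iff on a polydisc around `x`
one can write `a = Z(z)W(w)H_z` and `b = Z(z)W(w)H_w`. -/
theorem stmt_4 (U : Set (ℂ × ℂ)) (hU : IsOpen U) (x : ℂ × ℂ) (hx : x ∈ U)
    (a b : ℂ × ℂ → ℂ)
    (ha : DifferentiableOn ℂ a U) (hb : DifferentiableOn ℂ b U)
    (ha0 : ∀ p ∈ U, a p ≠ 0) (hb0 : ∀ p ∈ U, b p ≠ 0) :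
    ClosedAt U (fun _ => 0) a b (fun _ => 0) x ↔
      ∃ D1 D2 : Set ℂ, IsPolydisc D1 D2 ∧ D1 ×ˢ D2 ⊆ U ∧ x ∈ D1 ×ˢ D2 ∧
        ∃ Z W : ℂ → ℂ, ∃ H : ℂ × ℂ → ℂ,
          DifferentiableOn ℂ Z D1 ∧ (∀ z ∈ D1, Z z ≠ 0) ∧
          DifferentiableOn ℂ W D2 ∧ (∀ w ∈ D2, W w ≠ 0) ∧
          DifferentiableOn ℂ H (D1 ×ˢ D2) ∧
          ∀ p ∈ D1 ×ˢ D2, a p = Z p.1 * W p.2 * pz H p ∧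
                          b p = Z p.1 * W p.2 * pw H p := by
  constructor
  · rintro ⟨V, hV, hxV, hVU, ω1', ω2', ω3', hfac⟩
    obtain ⟨ω1, ω2, ω3, h, p1, p2⟩ := IsClosedFactorization.exists_ordered (V := V) (a := a)
      (b := b) hfac hxV (ha0 x hx)
    obtain ⟨r, hr, hsub, hD⟩ := h.exists_polydisc hV hxV (ha0 x hx) (hb0 x hx) p1 p2
    obtain ⟨d1, d2, d3, c1, c2, c3, he⟩ := h
    have hopen : IsOpen (Metric.ball x r) := Metric.isOpen_ball
    obtain ⟨H, hH, hdH⟩ := exists_primitive hopen (convex_ball x r)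
      ⟨d3.1.mono hsub, d3.2.mono hsub⟩ (fun p hp => c3 p (hsub hp))
    have hQ : ∀ p ∈ Metric.ball x r, pz ω1.2 p = 0 := fun p hp => by
      rw [← c1 p (hsub hp), pw, fderiv_eq_zero_of_eqOn_zero hopen (fun q hq => (hD q hq).1) hp]
      rfl
    have hP : ∀ p ∈ Metric.ball x r, pw ω2.1 p = 0 := fun p hp => by
      rw [c2 p (hsub hp), pz, fderiv_eq_zero_of_eqOn_zero hopen (fun q hq => (hD q hq).2.1) hp]
      rfl
    have dQ := d1.2.mono hsub
    have dP := d2.1.mono hsub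
    obtain ⟨x1, x2⟩ := x
    rw [← ball_prod_same] at hsub hD hQ hP dQ dP hH hdH hopen
    have m1 := Metric.mem_ball_self (x := x1) hr
    have m2 := Metric.mem_ball_self (x := x2) hr
    have cb : ∀ c : ℂ, IsPreconnected (Metric.ball c r) := fun c =>
      (convex_ball c r).isPreconnected
    refine ⟨Metric.ball x1 r, Metric.ball x2 r, ⟨x1, x2, r, r, hr, hr, rfl, rfl⟩,
      hsub.trans hVU, ⟨m1, m2⟩, fun z => ω2.1 (z, x2), fun w => ω1.2 (x1, w), H, ?_,
      fun z hz => (hD (z, x2) ⟨hz, m2⟩).2.2.1, ?_,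
      fun w hw => (hD (x1, w) ⟨m1, hw⟩).2.2.2, hH, ?_⟩
    · exact fun z hz => (hasDerivAt_slice_fst (dP.differentiableAt
        (hopen.mem_nhds ⟨hz, m2⟩))).differentiableAt.differentiableWithinAt
    · exact fun w hw => (hasDerivAt_slice_snd (dQ.differentiableAt
        (hopen.mem_nhds ⟨m1, hw⟩))).differentiableAt.differentiableWithinAt
    · rintro ⟨z, w⟩ hp
      obtain ⟨-, e1, e2, -⟩ := he _ (hsub hp)
      obtain ⟨z1, z2, -, -⟩ := hD _ hp
      rw [e1, e2, (hdH _ hp).1, (hdH _ hp).2, symC1, symC2, z1, z2,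
        eq_of_pw_eq_zero Metric.isOpen_ball Metric.isOpen_ball (cb x2) dP hP hp.1 hp.2 m2,
        eq_of_pz_eq_zero Metric.isOpen_ball Metric.isOpen_ball (cb x1) dQ hQ hp.1 m1 hp.2]
      constructor <;> ring
  · rintro ⟨D1, D2, ⟨z0, w0, r1, r2, -, -, rfl, rfl⟩, hDU, hxD, Z, W, H, hZ, hZ0, hW, hW0, hH, he⟩
    have hD : IsOpen (Metric.ball z0 r1 ×ˢ Metric.ball w0 r2) :=
      Metric.isOpen_ball.prod Metric.isOpen_ball
    set D := Metric.ball z0 r1 ×ˢ Metric.ball w0 r2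
    have hZ' : DifferentiableOn ℂ (fun p : ℂ × ℂ => Z p.1) D :=
      hZ.comp differentiableOn_fst fun p hp => hp.1
    have hW' : DifferentiableOn ℂ (fun p : ℂ × ℂ => W p.2) D :=
      hW.comp differentiableOn_snd fun p hp => hp.2
    have hne : ∀ p ∈ D, Z p.1 * W p.2 ≠ 0 := fun p hp => mul_ne_zero (hZ0 _ hp.1) (hW0 _ hp.2)
    have hinv : DifferentiableOn ℂ (fun p : ℂ × ℂ => (Z p.1 * W p.2)⁻¹) D :=
      (hZ'.mul hW').fun_inv hne
    have hdH : HoloForm (dfun H) D := by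
      constructor
      · refine ((ha.mono hDU).mul hinv).congr fun p hp => ?_
        change pz H p = a p * (Z p.1 * W p.2)⁻¹
        rw [← div_eq_mul_inv]
        exact eq_div_of_mul_eq (hne p hp) (by rw [(he p hp).1]; exact mul_comm _ _)
      · refine ((hb.mono hDU).mul hinv).congr fun p hp => ?_
        change pw H p = b p * (Z p.1 * W p.2)⁻¹
        rw [← div_eq_mul_inv]
        exact eq_div_of_mul_eq (hne p hp) (by rw [(he p hp).2]; exact mul_comm _ _)
    refine ⟨D, hD, hxD, hDU, (fun p => Z p.1, fun _ => 0), (fun _ => 0, fun p => W p.2), dfun H,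
      ⟨hZ', differentiableOn_const 0⟩, ⟨differentiableOn_const 0, hW'⟩, hdH, ?_, ?_,
      isClosed1_dfun hD hH hdH, fun p hp => ?_⟩
    · rintro ⟨z, w⟩ hp
      have h := hasDerivAt_slice_snd (hZ'.differentiableAt (hD.mem_nhds hp))
      rw [← h.deriv]
      simp [pz]
    · rintro ⟨z, w⟩ hp
      have h := hasDerivAt_slice_fst (hW'.differentiableAt (hD.mem_nhds hp))
      rw [← h.deriv]
      simp [pw]
    · simp [symC0, symC1, symC2, symC3, dfun, he p hp]
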